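/- arXiv:2502.16070 — 5 statements merged into one kernel-verified Lean document; each statement's English description precedes it below -/
import Mathlib

section
/- For each n ∈ ℕ let p_n be the monic real polynomial of degree n with ∫_{−1}^1 p_n(x) x^j (1−x)^{α+1}(1+x)^{β+1} dx = 0 for all 0 ≤ j < n (the monic Jacobi polynomial with parameters α+1, β+1), and define the 2×2 matrix polynomial Q_n(x) = p_n′(x)·V₁(x) + p_n(x)·V₀. Then for all n ≠ m, ∫_{−1}^1 Q_n(x) W(x) Q_m(x)* dx = 0; that is, (Q_n)_{n≥0} is a sequence of orthogonal matrix polynomials with respect to the weight W. -/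
open Polynomial

/-- 2×2 matrix polynomials with complex coefficients. -/
abbrev MatPoly2 := Matrix (Fin 2) (Fin 2) (Polynomial ℂ)

/-- Entrywise derivative of a matrix polynomial. -/
noncomputable def matDeriv (P : MatPoly2) : MatPoly2 := Matrix.of fun i j => derivative (P i j)

/-- First-order coefficient of the operator `𝒱`. -/
noncomputable def V1 (α β v : ℂ) : MatPoly2 :=
  !![X + C ((β - α) / v), C (1 + (β - α) / v);
     C (1 + (α - β) / v), X + C ((α - β) / v)]

/-- Zeroth-order coefficient of the operator `𝒱`. -/
noncomputable def V0 (α β v : ℂ) : MatPoly2 :=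
  !![C ((v + α + β + 2) / 2), 0;
     0, C ((-v + α + β + 2) / 2)]

/-- First-order coefficient of the operator `𝒩`. -/
noncomputable def N1 (α β v : ℂ) : MatPoly2 :=
  !![-X + C ((β - α) / v), C (1 + (β - α) / v);
     C (1 + (α - β) / v), -X + C ((α - β) / v)]

/-- Zeroth-order coefficient of the operator `𝒩`. -/
noncomputable def N0 (α β v : ℂ) : MatPoly2 :=
  !![C (-(-v + α + β + 4) / 2), 0;
     0, C (-(v + α + β + 4) / 2)]

/-- The right action of `𝒱`: `P·𝒱 = P′ V₁ + P V₀`. -/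
noncomputable def actV (α β v : ℂ) (P : MatPoly2) : MatPoly2 :=
  matDeriv P * V1 α β v + P * V0 α β v

/-- The right action of `𝒩`: `P·𝒩 = P′ N₁ + P N₀`. -/
noncomputable def actN (α β v : ℂ) (P : MatPoly2) : MatPoly2 :=
  matDeriv P * N1 α β v + P * N0 α β v

/-- The matrix coefficient `W₂` of the Jacobi-type weight. -/
noncomputable def W2m (α β v : ℝ) : Matrix (Fin 2) (Fin 2) ℂ :=
  !![((v * (v + α + β + 2) / (v + α - β) : ℝ) : ℂ), 0;
     0, ((v * (-v + α + β + 2) / (v - α + β) : ℝ) : ℂ)]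

/-- The matrix coefficient `W₁` of the Jacobi-type weight. -/
noncomputable def W1m (α β v : ℝ) : Matrix (Fin 2) (Fin 2) ℂ :=
  !![((-(v + α + β + 2) : ℝ) : ℂ), ((α + β + 2 : ℝ) : ℂ);
     ((α + β + 2 : ℝ) : ℂ), ((-(-v + α + β + 2) : ℝ) : ℂ)]

/-- The matrix coefficient `W₀` of the Jacobi-type weight. -/
noncomputable def W0m (α : ℝ) : Matrix (Fin 2) (Fin 2) ℂ :=
  !![((α + 1 : ℝ) : ℂ), ((-(α + 1) : ℝ) : ℂ);
     ((-(α + 1) : ℝ) : ℂ), ((α + 1 : ℝ) : ℂ)]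

/-- The irreducible Jacobi-type weight
`W(x) = (1−x)^α (1+x)^β (W₂(1−x)²/4 + W₁(1−x)/2 + W₀)`. -/
noncomputable def Wjac (α β v : ℝ) (x : ℝ) : Matrix (Fin 2) (Fin 2) ℂ :=
  (((1 - x) ^ α * (1 + x) ^ β : ℝ) : ℂ) •
    ((((1 - x) ^ 2 / 4 : ℝ) : ℂ) • W2m α β v + (((1 - x) / 2 : ℝ) : ℂ) • W1m α β v + W0m α)

/-- The diagonal Jacobi weight `W̃(x) = (1−x)^{α+1}(1+x)^{β+1} I`. -/
noncomputable def Wtil (α β : ℝ) (x : ℝ) : Matrix (Fin 2) (Fin 2) ℂ :=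
  (((1 - x) ^ (α + 1) * (1 + x) ^ (β + 1) : ℝ) : ℂ) • (1 : Matrix (Fin 2) (Fin 2) ℂ)

/-- Pointwise evaluation of a matrix polynomial at a real number. -/
noncomputable def evalMat (P : MatPoly2) (x : ℝ) : Matrix (Fin 2) (Fin 2) ℂ :=
  Matrix.of fun i j => (P i j).eval (x : ℂ)

section JacobiFunctional

open MeasureTheory Set

theorem integrableOn_jacobi_weight {a b : ℝ} (ha : -1 < a) (hb : -1 < b) :
    IntegrableOn (fun x : ℝ => (1 - x) ^ a * (1 + x) ^ b) (Ioo (-1) 1) := by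
  have key : ∀ {c d : ℝ}, -1 < c →
      IntegrableOn (fun x : ℝ => (1 + x) ^ c * (1 - x) ^ d) (Ioc (-1) 0) := by
    intro c d hc
    rw [← integrableOn_Icc_iff_integrableOn_Ioc]
    have h : IntervalIntegrable (fun x : ℝ => (1 + x) ^ c) volume (-1) 0 := by
      have := (intervalIntegral.intervalIntegrable_rpow' (a := 0) (b := 1) hc).comp_add_left 1
      simpa using this
    rw [intervalIntegrable_iff_integrableOn_Icc_of_le (by norm_num)] at h
    refine h.mul_continuousOn ?_ isCompact_Icc
    refine ContinuousOn.rpow_const (by fun_prop) fun x hx => Or.inl ?_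
    linarith [hx.2]
  have hleft := key (d := a) hb
  have hright : IntegrableOn (fun x : ℝ => (1 - x) ^ a * (1 + x) ^ b) (Ico 0 1) := by
    have h := (key (d := b) ha).comp_neg
    simpa [sub_eq_add_neg] using h
  refine (hleft.congr_fun (fun x _ => mul_comm _ _) measurableSet_Ioc |>.union hright).mono_set ?_
  intro x hx
  rcases le_or_gt x 0 with h | h
  · exact Or.inl ⟨hx.1, h⟩
  · exact Or.inr ⟨h.le, hx.2⟩

theorem integrableOn_jacobi_weight_mul_eval {a b : ℝ} (ha : -1 < a) (hb : -1 < b) (q : ℝ[X]) :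
    IntegrableOn (fun x : ℝ => (1 - x) ^ a * (1 + x) ^ b * q.eval x) (Ioo (-1) 1) := by
  rw [← integrableOn_Icc_iff_integrableOn_Ioo]
  refine IntegrableOn.mul_continuousOn ?_ q.continuous.continuousOn isCompact_Icc
  rw [integrableOn_Icc_iff_integrableOn_Ioo]
  exact integrableOn_jacobi_weight ha hb

/-- Integration of a polynomial against `(1 - x) ^ a * (1 + x) ^ b` on `(-1, 1)`. -/
noncomputable def jacobiFunctional {a b : ℝ} (ha : -1 < a) (hb : -1 < b) : ℝ[X] →ₗ[ℝ] ℝ where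
  toFun q := ∫ x in Ioo (-1 : ℝ) 1, (1 - x) ^ a * (1 + x) ^ b * q.eval x
  map_add' q r := by
    rw [← integral_add (integrableOn_jacobi_weight_mul_eval ha hb q)
      (integrableOn_jacobi_weight_mul_eval ha hb r)]
    simp only [eval_add, mul_add]
  map_smul' c q := by
    rw [RingHom.id_apply, smul_eq_mul, ← integral_const_mul]
    simp only [eval_smul, smul_eq_mul, mul_left_comm]

theorem jacobiFunctional_apply {a b : ℝ} (ha : -1 < a) (hb : -1 < b) (q : ℝ[X]) :
    jacobiFunctional ha hb q = ∫ x in Ioo (-1 : ℝ) 1, (1 - x) ^ a * (1 + x) ^ b * q.eval x :=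
  rfl

/-- Raising both exponents by one multiplies the weight by `1 - x ^ 2`. -/
theorem jacobiFunctional_one_sub_sq_mul {a b : ℝ} (ha : -1 < a) (hb : -1 < b)
    (ha' : -1 < a + 1) (hb' : -1 < b + 1) (q : ℝ[X]) :
    jacobiFunctional ha hb ((1 - X ^ 2) * q) = jacobiFunctional ha' hb' q := by
  refine setIntegral_congr_fun measurableSet_Ioo fun x hx => ?_
  have h₁ : 1 - x ≠ 0 := by linarith [hx.2]
  have h₂ : 1 + x ≠ 0 := by linarith [hx.1]
  simp only [eval_mul, eval_sub, eval_one, eval_pow, eval_X, Real.rpow_add_one h₁,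
    Real.rpow_add_one h₂]
  ring

/-- The Pearson equation of the Jacobi weight, integrated: the boundary terms vanish. -/
theorem jacobiFunctional_pearson {a b : ℝ} (ha : -1 < a) (hb : -1 < b) (q : ℝ[X]) :
    jacobiFunctional ha hb
      ((1 - X ^ 2) * derivative q + (C (b - a) - C (a + b + 2) * X) * q) = 0 := by
  set r := (1 - X ^ 2) * derivative q + (C (b - a) - C (a + b + 2) * X) * q with hr
  let F : ℝ → ℝ := fun x => (1 - x) ^ (a + 1) * (1 + x) ^ (b + 1) * q.eval x
  have hcont : ContinuousOn F (Icc (-1) 1) := by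
    refine ContinuousOn.mul (ContinuousOn.mul ?_ ?_) q.continuous.continuousOn
    · exact ContinuousOn.rpow_const (by fun_prop) fun x _ => Or.inr (by linarith)
    · exact ContinuousOn.rpow_const (by fun_prop) fun x _ => Or.inr (by linarith)
  have hderiv : ∀ x ∈ Ioo (-1 : ℝ) 1,
      HasDerivAt F ((1 - x) ^ a * (1 + x) ^ b * r.eval x) x := by
    intro x hx
    have h₁ : 1 - x ≠ 0 := by linarith [hx.2]
    have h₂ : 1 + x ≠ 0 := by linarith [hx.1]
    have d₁ := ((hasDerivAt_id x).const_sub 1).rpow_const (p := a + 1) (Or.inl h₁)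
    have d₂ := ((hasDerivAt_id x).const_add 1).rpow_const (p := b + 1) (Or.inl h₂)
    refine ((d₁.mul d₂).mul (q.hasDerivAt x)).congr_deriv ?_
    simp only [id, hr, eval_add, eval_mul, eval_sub, eval_one, eval_pow, eval_X, eval_C,
      Real.rpow_add_one h₁, Real.rpow_add_one h₂, add_sub_cancel_right, Pi.mul_apply]
    ring
  have hint : IntervalIntegrable (fun x => (1 - x) ^ a * (1 + x) ^ b * r.eval x)
      volume (-1) 1 := by
    rw [intervalIntegrable_iff_integrableOn_Ioo_of_le (by norm_num)]
    exact integrableOn_jacobi_weight_mul_eval ha hb r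
  have h := intervalIntegral.integral_eq_sub_of_hasDerivAt_of_le (by norm_num) hcont hderiv hint
  rw [intervalIntegral.integral_of_le (by norm_num), integral_Ioc_eq_integral_Ioo] at h
  rw [jacobiFunctional_apply, h]
  have h₁ : a + 1 ≠ 0 := by linarith
  have h₂ : b + 1 ≠ 0 := by linarith
  simp [F, Real.zero_rpow h₁, Real.zero_rpow h₂]

theorem LinearMap.map_mul_eq_zero_of_natDegree_lt (L : ℝ[X] →ₗ[ℝ] ℝ) {p q : ℝ[X]} {n : ℕ}
    (h : ∀ j < n, L (p * X ^ j) = 0) (hq : q.natDegree < n) : L (p * q) = 0 := by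
  rw [q.as_sum_range' n hq, Finset.mul_sum, map_sum]
  refine Finset.sum_eq_zero fun j hj => ?_
  rw [← C_mul_X_pow_eq_monomial, mul_left_comm, ← smul_eq_C_mul, map_smul,
    h j (Finset.mem_range.1 hj), smul_zero]

/-- The derivatives of Jacobi orthogonal polynomials are orthogonal with respect to the weight
with both exponents raised by one. -/
theorem jacobiFunctional_one_sub_sq_mul_derivative_mul_derivative {a b : ℝ}
    (ha : -1 < a) (hb : -1 < b) {p q : ℝ[X]} {n : ℕ}
    (h : ∀ j < n, jacobiFunctional ha hb (p * X ^ j) = 0) (hq : q.natDegree < n) :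
    jacobiFunctional ha hb ((1 - X ^ 2) * (derivative p * derivative q)) = 0 := by
  have hP := jacobiFunctional_pearson ha hb (p * derivative q)
  have hdeg : ((1 - X ^ 2) * derivative (derivative q)
      + (C (b - a) - C (a + b + 2) * X) * derivative q).natDegree < n := by
    refine lt_of_le_of_lt ?_ hq
    rcases Nat.eq_zero_or_pos q.natDegree with h0 | h0
    · simp [derivative_of_natDegree_zero h0]
    have h₁ := natDegree_derivative_le q
    refine natDegree_add_le_of_degree_le ?_ ?_
    · by_cases h2 : (derivative q).natDegree = 0
      · simp [derivative_of_natDegree_zero h2]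
      have h₂ := natDegree_derivative_le (derivative q)
      have h₃ : (1 - X ^ 2 : ℝ[X]).natDegree ≤ 2 := by compute_degree
      refine natDegree_mul_le.trans ?_
      omega
    · have h₃ : (C (b - a) - C (a + b + 2) * X : ℝ[X]).natDegree ≤ 1 := by compute_degree
      refine natDegree_mul_le.trans ?_
      omega
  have hz := LinearMap.map_mul_eq_zero_of_natDegree_lt _ h hdeg
  have hsplit : (1 - X ^ 2) * (derivative p * derivative q)
      = ((1 - X ^ 2) * derivative (p * derivative q)
          + (C (b - a) - C (a + b + 2) * X) * (p * derivative q))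
        - p * ((1 - X ^ 2) * derivative (derivative q)
          + (C (b - a) - C (a + b + 2) * X) * derivative q) := by
    rw [derivative_mul]
    ring
  rw [hsplit, map_sub, hP, hz, sub_zero]

/-- The combination produced by `Q_n W Q_m*`, entry by entry, integrates to zero. -/
theorem jacobiFunctional_darboux_entry {a b : ℝ} (ha : -1 < a) (hb : -1 < b)
    (ha' : -1 < a + 1) (hb' : -1 < b + 1) {p q : ℝ[X]} {n m : ℕ} (hnm : n ≠ m)
    (hp : ∀ j < n, jacobiFunctional ha' hb' (p * X ^ j) = 0)
    (hq : ∀ j < m, jacobiFunctional ha' hb' (q * X ^ j) = 0)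
    (hpn : p.natDegree = n) (hqm : q.natDegree = m) (k c : ℝ) (B : ℝ[X]) :
    jacobiFunctional ha hb
      (C k * ((1 - X ^ 2) * ((1 - X ^ 2) * (derivative p * derivative q)))
        + ((1 - X ^ 2) * derivative (p * q * B) + (C (b - a) - C (a + b + 2) * X) * (p * q * B))
        + C c * ((1 - X ^ 2) * (p * q))) = 0 := by
  have h : jacobiFunctional ha' hb' (p * q) = 0 ∧
      jacobiFunctional ha' hb' ((1 - X ^ 2) * (derivative p * derivative q)) = 0 := by
    rcases hnm.lt_or_gt with hlt | hlt
    · rw [mul_comm p q, mul_comm (derivative p)]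
      exact ⟨LinearMap.map_mul_eq_zero_of_natDegree_lt _ hq (hpn ▸ hlt),
        jacobiFunctional_one_sub_sq_mul_derivative_mul_derivative ha' hb' hq (hpn ▸ hlt)⟩
    · exact ⟨LinearMap.map_mul_eq_zero_of_natDegree_lt _ hp (hqm ▸ hlt),
        jacobiFunctional_one_sub_sq_mul_derivative_mul_derivative ha' hb' hp (hqm ▸ hlt)⟩
  rw [map_add, map_add, jacobiFunctional_pearson, ← smul_eq_C_mul, ← smul_eq_C_mul, map_smul,
    map_smul, jacobiFunctional_one_sub_sq_mul ha hb ha' hb',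
    jacobiFunctional_one_sub_sq_mul ha hb ha' hb', h.1, h.2]
  simp

end JacobiFunctional

open Matrix in
/-- **Orthogonal polynomials for `W` via Darboux.** If `p_n` is the monic Jacobi
polynomial of degree `n` with parameters `α+1, β+1`, then the matrix polynomials
`Q_n = p_n′·V₁ + p_n·V₀` are pairwise orthogonal with respect to the Jacobi-type
weight `W`. -/
theorem darboux_orthogonal_sequence (α β v : ℝ) (hα : -1 < α) (hβ : -1 < β)
    (h1 : |α - β| < |v|) (h2 : |v| < α + β + 2)
    (p : ℕ → Polynomial ℝ)
    (hpm : ∀ n, (p n).Monic) (hpd : ∀ n, (p n).natDegree = n)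
    (hportho : ∀ n, ∀ j < n,
      ∫ x in Set.Ioo (-1 : ℝ) 1,
        (p n).eval x * x ^ j * ((1 - x) ^ (α + 1) * (1 + x) ^ (β + 1)) = 0)
    (Q : ℕ → MatPoly2)
    (hQ : ∀ n, Q n =
      derivative ((p n).map (algebraMap ℝ ℂ)) • V1 (α : ℂ) (β : ℂ) (v : ℂ)
        + ((p n).map (algebraMap ℝ ℂ)) • V0 (α : ℂ) (β : ℂ) (v : ℂ)) :
    ∀ n m, n ≠ m → ∀ i j : Fin 2,
      ∫ x in Set.Ioo (-1 : ℝ) 1, (evalMat (Q n) x * Wjac α β v x * (evalMat (Q m) x)ᴴ) i j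
        = 0 := by
  have hv : v ≠ 0 := fun h => by
    rw [h, abs_zero] at h1
    exact absurd h1 (abs_nonneg _).not_gt
  have hvp : v + α - β ≠ 0 := fun h => by
    rw [show v = -(α - β) by linarith, abs_neg] at h1
    exact lt_irrefl _ h1
  have hvm : v - α + β ≠ 0 := fun h => by
    rw [show v = α - β by linarith] at h1
    exact lt_irrefl _ h1
  have hα' : -1 < α + 1 := by linarith
  have hβ' : -1 < β + 1 := by linarith
  have horth : ∀ n, ∀ j < n, jacobiFunctional hα' hβ' (p n * X ^ j) = 0 := by
    intro n j hj
    rw [jacobiFunctional_apply, ← hportho n j hj]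
    refine MeasureTheory.integral_congr_ae (Filter.Eventually.of_forall fun x => ?_)
    simp only [eval_mul, eval_pow, eval_X]
    ring
  intro n m hnm i j
  suffices h : ∃ (k c : ℝ) (B : ℝ[X]), ∀ x : ℝ,
      (evalMat (Q n) x * Wjac α β v x * (evalMat (Q m) x)ᴴ) i j
        = (((1 - x) ^ α * (1 + x) ^ β *
          (C k * ((1 - X ^ 2) * ((1 - X ^ 2) * (derivative (p n) * derivative (p m))))
            + ((1 - X ^ 2) * derivative (p n * p m * B)
              + (C (β - α) - C (α + β + 2) * X) * (p n * p m * B))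
            + C c * ((1 - X ^ 2) * (p n * p m))).eval x : ℝ) : ℂ) by
    obtain ⟨k, c, B, h⟩ := h
    simp only [h]
    rw [integral_complex_ofReal, ← jacobiFunctional_apply hα hβ,
      jacobiFunctional_darboux_entry hα hβ hα' hβ' hnm (horth n) (horth m) (hpd n) (hpd m),
      Complex.ofReal_zero]
  refine ⟨(!![v * (v + α + β + 2) / (v + α - β) / 4, 0;
      0, v * (-v + α + β + 2) / (v - α + β) / 4] : Matrix (Fin 2) (Fin 2) ℝ) i j,
    (!![v * (v + α + β + 2) / (v + α - β) / 4 * ((v + α + β + 2) / 2)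
        * (α + β + 3 - (v + α + β + 2) / 2), 0;
      0, v * (-v + α + β + 2) / (v - α + β) / 4 * ((-v + α + β + 2) / 2)
        * (α + β + 3 - (-v + α + β + 2) / 2)] : Matrix (Fin 2) (Fin 2) ℝ) i j,
    (!![C (-(α - β) * (v + α + β + 2) ^ 2 / (8 * (v + α - β)))
          - C (v * (v + α + β + 2) ^ 2 / (8 * (v + α - β))) * X,
        C ((v + α + β + 2) * (-v + α + β + 2) / 8);
        C ((v + α + β + 2) * (-v + α + β + 2) / 8),
        C ((α - β) * (-v + α + β + 2) ^ 2 / (8 * (v - α + β)))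
          - C (v * (-v + α + β + 2) ^ 2 / (8 * (v - α + β))) * X] :
      Matrix (Fin 2) (Fin 2) ℝ[X]) i j, fun x => ?_⟩
  have hev : ∀ q : ℝ[X], (q.map (algebraMap ℝ ℂ)).eval (x : ℂ) = ((q.eval x : ℝ) : ℂ) :=
    fun q => (eval_map_algebraMap q _).trans (aeval_algebraMap_apply_eq_algebraMap_eval x q)
  have hQe : ∀ n, evalMat (Q n) x =
      (!![(derivative (p n)).eval x * (x + (β - α) / v)
            + (p n).eval x * ((v + α + β + 2) / 2),
          (derivative (p n)).eval x * (1 + (β - α) / v);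
          (derivative (p n)).eval x * (1 + (α - β) / v),
          (derivative (p n)).eval x * (x + (α - β) / v)
            + (p n).eval x * ((-v + α + β + 2) / 2)] : Matrix (Fin 2) (Fin 2) ℝ).map
        Complex.ofReal := by
    intro n
    ext i j
    fin_cases i <;> fin_cases j <;>
      simp [evalMat, hQ, V1, V0, derivative_map, hev]
  have hWe : Wjac α β v x = (((1 - x) ^ α * (1 + x) ^ β) •
      (((1 - x) ^ 2 / 4) • !![v * (v + α + β + 2) / (v + α - β), 0;
          0, v * (-v + α + β + 2) / (v - α + β)]
        + ((1 - x) / 2) • !![-(v + α + β + 2), α + β + 2; α + β + 2, -(-v + α + β + 2)]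
        + !![α + 1, -(α + 1); -(α + 1), α + 1]) : Matrix (Fin 2) (Fin 2) ℝ).map
        Complex.ofReal := by
    ext i j
    fin_cases i <;> fin_cases j <;> simp [Wjac, W2m, W1m, W0m]
  have hconj : ∀ M : Matrix (Fin 2) (Fin 2) ℝ,
      (M.map Complex.ofReal)ᴴ = (Mᵀ).map Complex.ofReal := fun M => by
    ext i j
    simp
  have hmul : ∀ M N : Matrix (Fin 2) (Fin 2) ℝ,
      M.map Complex.ofReal * N.map Complex.ofReal = (M * N).map Complex.ofReal :=
    fun M N => (Matrix.map_mul (f := Complex.ofRealHom)).symm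
  rw [hQe, hQe, hWe, hconj, hmul, hmul, Matrix.map_apply, Complex.ofReal_inj]
  generalize (1 - x) ^ α * (1 + x) ^ β = w
  fin_cases i <;> fin_cases j <;>
    (simp [Matrix.mul_apply, Fin.sum_univ_two, derivative_mul]
     generalize (p n).eval x = f
     generalize (p m).eval x = g
     generalize (derivative (p n)).eval x = f'
     generalize (derivative (p m)).eval x = g'
     field_simp
     ring)
end

section
/- The operators D₁, D₂, D₃, D₄ satisfy the identities D₂D₃ = D₁² + v·D₁ and D₃D₂ = D₄² − v·D₄, meaning that for every P ∈ Mat₂(ℂ[x]) one has P·(D₂D₃) = P·(D₁D₁) + v·(P·D₁) and P·(D₃D₂) = P·(D₄D₄) − v·(P·D₄). -/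
open Polynomial

/-- The elementary matrix `E₁₁`. -/
noncomputable def E11 : Matrix (Fin 2) (Fin 2) ℂ := !![1, 0; 0, 0]
/-- The elementary matrix `E₁₂`. -/
noncomputable def E12 : Matrix (Fin 2) (Fin 2) ℂ := !![0, 1; 0, 0]
/-- The elementary matrix `E₂₁`. -/
noncomputable def E21 : Matrix (Fin 2) (Fin 2) ℂ := !![0, 0; 1, 0]
/-- The elementary matrix `E₂₂`. -/
noncomputable def E22 : Matrix (Fin 2) (Fin 2) ℂ := !![0, 0; 0, 1]

/-- The right action of the operator `𝒩M𝒱` for a constant matrix `M`: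
`P·(𝒩M𝒱) = ((P·𝒩)M)·𝒱`.  Taking `M = E₁₁, E₁₂, E₂₁, E₂₂` gives the operators
`D₁, D₂, D₃, D₄`. -/
noncomputable def actD (α β v : ℂ) (M : Matrix (Fin 2) (Fin 2) ℂ) (P : MatPoly2) : MatPoly2 :=
  actV α β v (actN α β v P * M.map C)

theorem actV_add (α β v : ℂ) (P Q : MatPoly2) :
    actV α β v (P + Q) = actV α β v P + actV α β v Q := by
  have h : matDeriv (P + Q) = matDeriv P + matDeriv Q := by
    ext1 i j; simp [matDeriv]
  simp only [actV, h, add_mul]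
  abel

theorem actV_smul (α β v c : ℂ) (P : MatPoly2) :
    actV α β v (c • P) = c • actV α β v P := by
  have h : matDeriv (c • P) = c • matDeriv P := by
    ext1 i j; simp [matDeriv]
  simp only [actV, h, smul_mul_assoc, smul_add]

/-- The two diagonal entries of the composite `𝒱𝒩` differ by the constant `v`. -/
theorem actN_actV_diag (α β v : ℂ) (hv : v ≠ 0) (Q : MatPoly2) :
    actN α β v (actV α β v (Q * E12.map C)) * E21.map C
        = actN α β v (actV α β v (Q * E11.map C)) * E11.map C + v • (Q * E11.map C) ∧
    actN α β v (actV α β v (Q * E21.map C)) * E12.map C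
        = actN α β v (actV α β v (Q * E22.map C)) * E22.map C - v • (Q * E22.map C) := by
  obtain ⟨a, b, w, hα, hβ, rfl⟩ :
      ∃ a b w : ℂ, α = b - 1 - a * w ∧ β = b - 1 + a * w ∧ v = 2 * w :=
    ⟨(β - α) / v, (α + β + 2) / 2, v / 2, by field_simp; ring, by field_simp; ring, by ring⟩
  have hw : w ≠ 0 := right_ne_zero_of_mul hv
  have h1 : (β - α) / (2 * w) = a := by rw [hα, hβ]; field_simp; ring
  have h2 : (α - β) / (2 * w) = -a := by rw [hα, hβ]; field_simp; ring
  have h3 : (2 * w + α + β + 2) / 2 = b + w := by rw [hα, hβ]; ring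
  have h4 : (-(2 * w) + α + β + 2) / 2 = b - w := by rw [hα, hβ]; ring
  have h5 : -(-(2 * w) + α + β + 4) / 2 = -(b + 1 - w) := by rw [hα, hβ]; ring
  have h6 : -(2 * w + α + β + 4) / 2 = -(b + 1 + w) := by rw [hα, hβ]; ring
  have h7 : C (2 : ℂ) = 2 := rfl
  constructor <;> ext1 i j <;> fin_cases j <;>
    simp [actN, actV, V1, V0, N1, N0, h1, h2, h3, h4, h5, h6, h7, matDeriv, E11, E12, E21, E22,
      Matrix.mul_apply, Fin.sum_univ_two, smul_eq_C_mul, -neg_add_rev] <;>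
    ring

/-- **Relations `D₂D₃ = D₁² + vD₁` and `D₃D₂ = D₄² − vD₄`** for the operators
`D₁ = 𝒩E₁₁𝒱`, `D₂ = 𝒩E₁₂𝒱`, `D₃ = 𝒩E₂₁𝒱`, `D₄ = 𝒩E₂₂𝒱`. -/
theorem relations_D2D3_D3D2 (α β v : ℂ) (hv : v ≠ 0) (P : MatPoly2) :
    actD α β v E21 (actD α β v E12 P)
        = actD α β v E11 (actD α β v E11 P) + v • actD α β v E11 P ∧
    actD α β v E12 (actD α β v E21 P)
        = actD α β v E22 (actD α β v E22 P) - v • actD α β v E22 P := by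
  obtain ⟨h₁, h₂⟩ := actN_actV_diag α β v hv (actN α β v P)
  simp only [actD, h₁, h₂]
  exact ⟨by rw [actV_add, actV_smul],
    by rw [sub_eq_add_neg, ← neg_smul, actV_add, actV_smul, neg_smul, ← sub_eq_add_neg]⟩
end

section
/- The operators D₁, D₂, D₃, D₄ satisfy the identities D₁D₂ − D₂D₄ = −v·D₂ and D₄D₃ − D₃D₁ = v·D₃, meaning that for every P ∈ Mat₂(ℂ[x]) one has P·(D₁D₂) − P·(D₂D₄) = −v·(P·D₂) and P·(D₄D₃) − P·(D₃D₁) = v·(P·D₃). -/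
open Polynomial

theorem actV_sub (α β v : ℂ) (P Q : MatPoly2) :
    actV α β v (P - Q) = actV α β v P - actV α β v Q := by
  have h : matDeriv (P - Q) = matDeriv P - matDeriv Q := by
    ext1 i j
    simp [matDeriv]
  simp only [actV, h, Matrix.sub_mul]
  abel

/-- The diagonal entries of `𝒱𝒩`, as scalar operators, differ by the constant `-v`. -/
theorem actN_actV_diag_sub (α β v : ℂ) (Q : MatPoly2) :
    actN α β v (actV α β v (Q * E11.map C)) * E12.map C
        - actN α β v (actV α β v (Q * E12.map C)) * E22.map C = -v • (Q * E12.map C) ∧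
    actN α β v (actV α β v (Q * E22.map C)) * E21.map C
        - actN α β v (actV α β v (Q * E21.map C)) * E11.map C = v • (Q * E21.map C) := by
  obtain ⟨d, hd⟩ : ∃ d, (β - α) / v = d := ⟨_, rfl⟩
  have hd' : (α - β) / v = -d := by rw [← hd]; ring
  obtain ⟨a, rfl⟩ : ∃ a, β = 2 * a - v - α := ⟨(v + α + β) / 2, by ring⟩
  have hV₁ : (v + α + (2 * a - v - α) + 2) / 2 = a + 1 := by ring
  have hV₂ : (-v + α + (2 * a - v - α) + 2) / 2 = a - v + 1 := by ring
  have hN₁ : -(-v + α + (2 * a - v - α) + 4) / 2 = -(a - v + 2) := by ring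
  have hN₂ : -(v + α + (2 * a - v - α) + 4) / 2 = -(a + 2) := by ring
  have h2 : (C 2 : ℂ[X]) = 2 := C_ofNat 2
  constructor <;>
  · ext1 i j
    fin_cases j <;>
    simp only [actN, actV, matDeriv, V1, N1, V0, N0, hd, hd', hV₁, hV₂, hN₁, hN₂] <;>
    simp [E11, E12, E21, E22, Matrix.mul_apply, smul_eq_C_mul, h2]
    ring

/-- **Relations `D₁D₂ − D₂D₄ = −vD₂` and `D₄D₃ − D₃D₁ = vD₃`** for the operators
`D₁ = 𝒩E₁₁𝒱`, `D₂ = 𝒩E₁₂𝒱`, `D₃ = 𝒩E₂₁𝒱`, `D₄ = 𝒩E₂₂𝒱`. -/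
theorem relations_D1D2_D4D3 (α β v : ℂ) (hv : v ≠ 0) (P : MatPoly2) :
    actD α β v E12 (actD α β v E11 P) - actD α β v E22 (actD α β v E12 P)
        = -v • actD α β v E12 P ∧
    actD α β v E21 (actD α β v E22 P) - actD α β v E11 (actD α β v E21 P)
        = v • actD α β v E21 P := by
  have h := actN_actV_diag_sub α β v
  simp only [actD, ← actV_sub, ← actV_smul]
  exact ⟨by rw [(h _).1], by rw [(h _).2]⟩
end

section
/- The operators D₁, D₂, D₃, D₄ satisfy the vanishing relations D₁D₄ = D₄D₁ = 0, D₁D₃ = 0, D₄D₂ = 0, D₂D₁ = 0, D₂² = 0, D₃D₄ = 0 and D₃² = 0; that is, for every P ∈ Mat₂(ℂ[x]), each of the composites P·(D₁D₄), P·(D₄D₁), P·(D₁D₃), P·(D₄D₂), P·(D₂D₁), P·(D₂D₂), P·(D₃D₄), P·(D₃D₃) is the zero matrix polynomial. -/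
open Polynomial

/-- If the second column of `Q` vanishes, so does the second column of `Q·𝒱𝒩`. -/
lemma actN_actV_col_one (α β v : ℂ) {Q : MatPoly2} (hQ : ∀ i, Q i 1 = 0) (i : Fin 2) :
    actN α β v (actV α β v Q) i 1 = 0 := by
  have h : (C ((v + α + β + 2) / 2) : ℂ[X]) + 1 = C ((v + α + β + 4) / 2) := by
    rw [← C_1, ← C_add]; congr 1; ring
  have h' : (C (-(v + α + β + 4) / 2) : ℂ[X]) = -C ((v + α + β + 4) / 2) := by
    rw [← C_neg, neg_div]
  have hd : (C ((α - β) / v) : ℂ[X]) = -C ((β - α) / v) := by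
    rw [← C_neg, ← neg_div, neg_sub]
  simp [actN, actV, matDeriv, V0, V1, N0, N1, Matrix.mul_apply, Fin.sum_univ_two, hQ,
    -map_add, -map_sub, -map_neg, -map_div₀, -neg_add_rev]
  rw [h', hd, ← h]
  ring

/-- If the first column of `Q` vanishes, so does the first column of `Q·𝒱𝒩`. -/
lemma actN_actV_col_zero (α β v : ℂ) {Q : MatPoly2} (hQ : ∀ i, Q i 0 = 0) (i : Fin 2) :
    actN α β v (actV α β v Q) i 0 = 0 := by
  have h : (C ((-v + α + β + 2) / 2) : ℂ[X]) + 1 = C ((-v + α + β + 4) / 2) := by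
    rw [← C_1, ← C_add]; congr 1; ring
  have h' : (C (-(-v + α + β + 4) / 2) : ℂ[X]) = -C ((-v + α + β + 4) / 2) := by
    rw [← C_neg, neg_div]
  have hd : (C ((α - β) / v) : ℂ[X]) = -C ((β - α) / v) := by
    rw [← C_neg, ← neg_div, neg_sub]
  simp [actN, actV, matDeriv, V0, V1, N0, N1, Matrix.mul_apply, Fin.sum_univ_two, hQ,
    -map_add, -map_sub, -map_neg, -map_div₀, -neg_add_rev]
  rw [h', hd, ← h]
  ring

lemma actV_zero (α β v : ℂ) : actV α β v 0 = 0 := by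
  have h : matDeriv 0 = 0 := by ext1 i j; simp [matDeriv]
  simp [actV, h]

/-- If `A` has zero second column and `B` zero first row, then `(𝒩A𝒱)(𝒩B𝒱) = 0`. -/
lemma actD_actD_eq_zero_of_col_one (α β v : ℂ) {A B : Matrix (Fin 2) (Fin 2) ℂ}
    (hA : ∀ i, A i 1 = 0) (hB : ∀ j, B 0 j = 0) (P : MatPoly2) :
    actD α β v B (actD α β v A P) = 0 := by
  have h := actN_actV_col_one α β v (Q := actN α β v P * A.map C)
    fun i => by simp [Matrix.mul_apply, hA]
  rw [actD, actD]
  convert actV_zero α β v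
  ext1 i j
  simp [Matrix.mul_apply, Fin.sum_univ_two, h, hB]

/-- If `A` has zero first column and `B` zero second row, then `(𝒩A𝒱)(𝒩B𝒱) = 0`. -/
lemma actD_actD_eq_zero_of_col_zero (α β v : ℂ) {A B : Matrix (Fin 2) (Fin 2) ℂ}
    (hA : ∀ i, A i 0 = 0) (hB : ∀ j, B 1 j = 0) (P : MatPoly2) :
    actD α β v B (actD α β v A P) = 0 := by
  have h := actN_actV_col_zero α β v (Q := actN α β v P * A.map C)
    fun i => by simp [Matrix.mul_apply, hA]
  rw [actD, actD]
  convert actV_zero α β v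
  ext1 i j
  simp [Matrix.mul_apply, Fin.sum_univ_two, h, hB]

/-- **Vanishing relations** `D₁D₄ = D₄D₁ = 0`, `D₁D₃ = 0`, `D₄D₂ = 0`, `D₂D₁ = 0`,
`D₂² = 0`, `D₃D₄ = 0`, `D₃² = 0` for the operators `D₁ = 𝒩E₁₁𝒱`, `D₂ = 𝒩E₁₂𝒱`,
`D₃ = 𝒩E₂₁𝒱`, `D₄ = 𝒩E₂₂𝒱`. -/
theorem vanishing_relations (α β v : ℂ) (hv : v ≠ 0) (P : MatPoly2) :
    actD α β v E22 (actD α β v E11 P) = 0 ∧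
    actD α β v E11 (actD α β v E22 P) = 0 ∧
    actD α β v E21 (actD α β v E11 P) = 0 ∧
    actD α β v E12 (actD α β v E22 P) = 0 ∧
    actD α β v E11 (actD α β v E12 P) = 0 ∧
    actD α β v E12 (actD α β v E12 P) = 0 ∧
    actD α β v E22 (actD α β v E21 P) = 0 ∧
    actD α β v E21 (actD α β v E21 P) = 0 := by
  refine ⟨actD_actD_eq_zero_of_col_one α β v ?_ ?_ P, actD_actD_eq_zero_of_col_zero α β v ?_ ?_ P,
    actD_actD_eq_zero_of_col_one α β v ?_ ?_ P, actD_actD_eq_zero_of_col_zero α β v ?_ ?_ P,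
    actD_actD_eq_zero_of_col_zero α β v ?_ ?_ P, actD_actD_eq_zero_of_col_zero α β v ?_ ?_ P,
    actD_actD_eq_zero_of_col_one α β v ?_ ?_ P, actD_actD_eq_zero_of_col_one α β v ?_ ?_ P⟩ <;>
  simp [Fin.forall_fin_two, E11, E12, E21, E22]
end

section
/- The operators Z₁ = D₁² + D₄² + v(D₁ − D₄) and Z₂ = D₁³ + D₄³ + (1/4)(−v+α+β+4)(v+α+β+2)(D₁² + vD₁) + (1/4)(−v+α+β+2)(v+α+β+4)(D₄² − vD₄) + v(D₁² − D₄²) commute with each of D₁, D₂, D₃, D₄; that is, for every P ∈ Mat₂(ℂ[x]) and every i ∈ {1,2,3,4}, P·(Z₁D_i) = P·(D_iZ₁) and P·(Z₂D_i) = P·(D_iZ₂). -/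
open Polynomial

/-- The right action of the central operator `Z₁ = D₁² + D₄² + v(D₁ − D₄)`. -/
noncomputable def actZ1 (α β v : ℂ) (P : MatPoly2) : MatPoly2 :=
  actD α β v E11 (actD α β v E11 P) + actD α β v E22 (actD α β v E22 P)
    + v • (actD α β v E11 P - actD α β v E22 P)

/-- The right action of the central operator
`Z₂ = D₁³ + D₄³ + (1/4)(−v+α+β+4)(v+α+β+2)(D₁² + vD₁)
      + (1/4)(−v+α+β+2)(v+α+β+4)(D₄² − vD₄) + v(D₁² − D₄²)`. -/
noncomputable def actZ2 (α β v : ℂ) (P : MatPoly2) : MatPoly2 :=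
  actD α β v E11 (actD α β v E11 (actD α β v E11 P))
    + actD α β v E22 (actD α β v E22 (actD α β v E22 P))
    + ((-v + α + β + 4) * (v + α + β + 2) / 4) •
        (actD α β v E11 (actD α β v E11 P) + v • actD α β v E11 P)
    + ((-v + α + β + 2) * (v + α + β + 4) / 4) •
        (actD α β v E22 (actD α β v E22 P) - v • actD α β v E22 P)
    + v • (actD α β v E11 (actD α β v E11 P) - actD α β v E22 (actD α β v E22 P))

/-- `𝒱` as a linear endomorphism. -/
noncomputable def linV (α β v : ℂ) : Module.End ℂ MatPoly2 where
  toFun := actV α β v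
  map_add' P Q := by
    ext i j : 1
    simp [actV, matDeriv, Matrix.mul_apply, Fin.sum_univ_two]
    ring
  map_smul' c P := by
    ext i j : 1
    simp [actV, matDeriv, Matrix.mul_apply, Fin.sum_univ_two, smul_eq_C_mul]
    ring

/-- The scalar second-order operator
`(1 - x²)∂² + (β - α - (α + β + 4)x)∂ - (-v + α + β + 4)(v + α + β + 2)/4`. -/
noncomputable def jacobiOp (α β v : ℂ) : Module.End ℂ ℂ[X] where
  toFun p := (1 - X ^ 2) * derivative (derivative p)
    + (C (β - α) - C (α + β + 4) * X) * derivative p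
    - C ((-v + α + β + 4) * (v + α + β + 2) / 4) * p
  map_add' p q := by simp; ring
  map_smul' c p := by simp [smul_eq_C_mul]; ring

theorem jacobiOp_apply (α β v : ℂ) (p : ℂ[X]) :
    jacobiOp α β v p = (1 - X ^ 2) * derivative (derivative p)
      + (C (β - α) - C (α + β + 4) * X) * derivative p
      - C ((-v + α + β + 4) * (v + α + β + 2) / 4) * p := rfl

/-- The operator applying `s` to the first column and `t` to the second. -/
noncomputable def colOp (s t : Module.End ℂ ℂ[X]) (Q : MatPoly2) : MatPoly2 :=
  Matrix.of fun i => ![s (Q i 0), t (Q i 1)]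

theorem actN_actV (α β v : ℂ) (hv : v ≠ 0) (Q : MatPoly2) :
    actN α β v (actV α β v Q) = colOp (jacobiOp α β v) (jacobiOp α β v + v • 1) Q := by
  obtain ⟨a, s, u, rfl, rfl, rfl⟩ :
      ∃ a s u, v = 2 * u ∧ β = s - 1 + u * a ∧ α = s - 1 - u * a :=
    ⟨(β - α) / v, (α + β + 2) / 2, v / 2, by ring, by field_simp; ring, by field_simp; ring⟩
  have hu : u ≠ 0 := right_ne_zero_of_mul hv
  have e₁ : (s - 1 + u * a - (s - 1 - u * a)) / (2 * u) = a := by field_simp; ring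
  have e₂ : (s - 1 - u * a - (s - 1 + u * a)) / (2 * u) = -a := by field_simp; ring
  have e₃ : (2 * u + (s - 1 - u * a) + (s - 1 + u * a) + 2) / 2 = s + u := by ring
  have e₄ : (-(2 * u) + (s - 1 - u * a) + (s - 1 + u * a) + 2) / 2 = s - u := by ring
  have e₅ : -(-(2 * u) + (s - 1 - u * a) + (s - 1 + u * a) + 4) / 2 = u - s - 1 := by ring
  have e₆ : -(2 * u + (s - 1 - u * a) + (s - 1 + u * a) + 4) / 2 = -u - s - 1 := by ring
  have hJ (p : ℂ[X]) : jacobiOp (s - 1 - u * a) (s - 1 + u * a) (2 * u) p =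
      (1 - X ^ 2) * derivative (derivative p)
        + (2 * C u * C a - 2 * (C s + 1) * X) * derivative p
        + (C s + C u) * (C u - C s - 1) * p := by
    have h₁ : s - 1 + u * a - (s - 1 - u * a) = 2 * u * a := by ring
    have h₂ : s - 1 - u * a + (s - 1 + u * a) + 4 = 2 * (s + 1) := by ring
    have h₃ : (-(2 * u) + (s - 1 - u * a) + (s - 1 + u * a) + 4) *
        (2 * u + (s - 1 - u * a) + (s - 1 + u * a) + 2) / 4 = -((s + u) * (u - s - 1)) := by ring
    simp only [jacobiOp_apply, h₁, h₂, h₃, C_mul, C_add, C_sub, C_neg,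
      C_1, C_ofNat]
    ring
  ext i j : 1
  revert j
  simp only [Fin.forall_fin_two, actN, actV, matDeriv, V0, V1, N0, N1, e₁, e₂, e₃, e₄, e₅, e₆,
    colOp, hJ, Matrix.of_apply, Matrix.add_apply, Matrix.mul_apply, Fin.sum_univ_two,
    Matrix.cons_val_zero, Matrix.cons_val_one, Matrix.cons_val', Matrix.cons_val_fin_one,
    LinearMap.add_apply, LinearMap.smul_apply, Module.End.one_apply, smul_eq_C_mul,
    derivative_add, derivative_sub, derivative_mul, derivative_neg, derivative_X, derivative_C,
    derivative_zero, derivative_one, C_add, C_sub, C_neg, C_mul, C_1, C_ofNat]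
  constructor <;> ring

theorem actD_actV_colOp (α β v : ℂ) (hv : v ≠ 0) (M : Matrix (Fin 2) (Fin 2) ℂ)
    {s t ω : Module.End ℂ ℂ[X]}
    (hs : jacobiOp α β v * s = ω) (ht : (jacobiOp α β v + v • 1) * t = ω)
    (hs' : s * jacobiOp α β v = ω) (ht' : t * (jacobiOp α β v + v • 1) = ω) (P : MatPoly2) :
    actD α β v M (actV α β v (colOp s t (actN α β v P))) =
      actV α β v (colOp s t (actN α β v (actD α β v M P))) := by
  rw [actD, actD, actN_actV α β v hv, actN_actV α β v hv]
  congr 1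
  have comp (a b c d : Module.End ℂ ℂ[X]) (Q : MatPoly2) :
      colOp a b (colOp c d Q) = colOp (a * c) (b * d) Q := by
    ext i j : 1
    fin_cases j <;> rfl
  rw [comp, comp, hs, ht, hs', ht']
  ext i j : 1
  have hC (c : ℂ) (p : ℂ[X]) : ω (p * C c) = ω p * C c := by
    simp only [mul_comm _ (C c), ← smul_eq_C_mul, map_smul]
  fin_cases j <;> simp [colOp, Matrix.mul_apply, Fin.sum_univ_two, hC]

theorem actZ1_eq (α β v : ℂ) (hv : v ≠ 0) (P : MatPoly2) :
    actZ1 α β v P =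
      actV α β v (colOp (jacobiOp α β v + v • 1) (jacobiOp α β v) (actN α β v P)) := by
  have hV (Q) : actV α β v Q = linV α β v Q := rfl
  simp only [actZ1, actD, actN_actV α β v hv]
  simp only [hV, ← map_add, ← map_sub, ← map_smul]
  refine congrArg (linV α β v) ?_
  generalize jacobiOp α β v = J
  ext i j : 1
  fin_cases j <;> simp [colOp, E11, E22, Matrix.mul_apply, Fin.sum_univ_two]

theorem actZ2_eq (α β v : ℂ) (hv : v ≠ 0) (P : MatPoly2) :
    actZ2 α β v P = actV α β v (colOp
      (jacobiOp α β v * jacobiOp α β v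
        + ((-v + α + β + 4) * (v + α + β + 2) / 4) • (jacobiOp α β v + v • 1)
        + v • jacobiOp α β v)
      (jacobiOp α β v * jacobiOp α β v
        + ((-v + α + β + 2) * (v + α + β + 4) / 4) • jacobiOp α β v
        + v • jacobiOp α β v)
      (actN α β v P)) := by
  have hV (Q) : actV α β v Q = linV α β v Q := rfl
  simp only [actZ2, actD, actN_actV α β v hv]
  simp only [hV, ← map_add, ← map_sub, ← map_smul]
  refine congrArg (linV α β v) ?_
  generalize jacobiOp α β v = J
  ext i j : 1
  fin_cases j <;> simp [colOp, E11, E22, Matrix.mul_apply, Fin.sum_univ_two]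
  module

/-- **`Z₁` and `Z₂` are central:** they commute with each of `D₁, D₂, D₃, D₄`. -/
theorem Z1_Z2_central (α β v : ℂ) (hv : v ≠ 0) (P : MatPoly2) :
    ∀ M ∈ ({E11, E12, E21, E22} : Set (Matrix (Fin 2) (Fin 2) ℂ)),
      actD α β v M (actZ1 α β v P) = actZ1 α β v (actD α β v M P) ∧
      actD α β v M (actZ2 α β v P) = actZ2 α β v (actD α β v M P) := by
  intro M _
  simp only [actZ1_eq α β v hv, actZ2_eq α β v hv]
  generalize hJ : jacobiOp α β v = J
  constructor
  · refine actD_actV_colOp α β v hv M (ω := J * J + v • J) ?_ ?_ ?_ ?_ P <;>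
    · rw [hJ]
      simp only [mul_add, add_mul, smul_mul_assoc, mul_smul_comm, one_mul, mul_one]
  · refine actD_actV_colOp α β v hv M (ω := J * (J * J)
      + ((-v + α + β + 4) * (v + α + β + 2) / 4) • (J * J + v • J) + v • (J * J)) ?_ ?_ ?_ ?_ P
    all_goals
      simp only [hJ, mul_add, add_mul, smul_mul_assoc, mul_smul_comm, one_mul, mul_one, smul_add,
        mul_assoc]
    all_goals module
end
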